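/- arXiv:2511.08524 — 2 statements merged into one kernel-verified Lean document; each statement's English description precedes it below -/
import Mathlib

section
/- Let a_n = 2·∑_{k=1}^{n} t_k·3^{n−k}·C(2n, n−k). Then a_n ~ (√3·Γ(1/4)·12^n)/(2π·n^{1/4}) as n → ∞; that is, lim_{n→∞} a_n · 2π·n^{1/4} / (√3·Γ(1/4)·12^n) = 1. (This is the asymptotic number of rooted well-labelled unicycles with n edges.) -/
open Filter

/-- The central trinomial coefficient `t_k`: the number of sequences
`(s_1, …, s_k) ∈ {-1,0,1}^k` with `s_1 + ⋯ + s_k = 0`. -/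
def trinom (k : ℕ) : ℕ :=
  (Finset.univ.filter (fun s : Fin k → Fin 3 => (∑ i, ((s i : ℤ) - 1)) = 0)).card

/-- `a_n = 2 ∑_{k=1}^n t_k 3^{n-k} C(2n, n-k)`, the number of rooted
well-labelled unicycles with `n` edges. -/
noncomputable def aSeq (n : ℕ) : ℝ :=
  2 * ∑ k ∈ Finset.Icc 1 n,
    (trinom k : ℝ) * (3 : ℝ) ^ (n - k) * (Nat.choose (2 * n) (n - k) : ℝ)

section

open Real Set MeasureTheory Topology

theorem integral_cexp_int_mul_I (m : ℤ) :
    ∫ θ in (-π)..π, Complex.exp ((m * Complex.I) * (θ : ℂ)) =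
      if m = 0 then 2 * (π : ℂ) else 0 := by
  split_ifs with h
  · subst h
    simp only [Int.cast_zero, zero_mul, Complex.exp_zero, intervalIntegral.integral_const]
    rw [Complex.real_smul]
    push_cast
    ring
  · have hc : (m * Complex.I : ℂ) ≠ 0 := mul_ne_zero (by exact_mod_cast h) Complex.I_ne_zero
    rw [integral_exp_mul_complex hc]
    have : (m * Complex.I : ℂ) * (π : ℝ) =
        (m * Complex.I) * ((-π : ℝ) : ℂ) + m * (2 * π * Complex.I) := by
      push_cast
      ring
    rw [this, Complex.exp_add, Complex.exp_int_mul_two_pi_mul_I]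
    simp

theorem integral_one_add_two_mul_cos_pow (k : ℕ) :
    ∫ θ in (-π)..π, (1 + 2 * cos θ) ^ k = 2 * π * trinom k := by
  have key (θ : ℝ) : (((1 + 2 * cos θ) ^ k : ℝ) : ℂ) =
      ∑ s : Fin k → Fin 3, Complex.exp (((∑ i, ((s i : ℤ) - 1) : ℤ) * Complex.I) * (θ : ℂ)) := by
    have h3 : ((1 + 2 * cos θ : ℝ) : ℂ) =
        ∑ a : Fin 3, Complex.exp ((((a : ℤ) - 1 : ℤ) * Complex.I) * (θ : ℂ)) := by
      rw [Fin.sum_univ_three]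
      push_cast [Complex.cos]
      norm_num
      ring_nf
    rw [Complex.ofReal_pow, h3, Fintype.sum_pow]
    refine Finset.sum_congr rfl fun s _ => ?_
    rw [← Complex.exp_sum]
    push_cast
    rw [Finset.sum_mul, Finset.sum_mul]
  apply Complex.ofReal_injective
  rw [← intervalIntegral.integral_ofReal]
  simp_rw [key]
  rw [intervalIntegral.integral_finsetSum
    (fun s _ => Continuous.intervalIntegrable (by fun_prop) _ _)]
  simp_rw [integral_cexp_int_mul_I]
  rw [Finset.sum_ite]
  simp [trinom, mul_comm]

theorem abs_one_add_two_mul_cos_div_three_le {θ : ℝ} (h : |θ| ≤ π) :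
    |(1 + 2 * cos θ) / 3| ≤ exp (-(1 / π ^ 2) * θ ^ 2) := by
  have hpi : 0 < π ^ 2 := by positivity
  have hsq : θ ^ 2 ≤ π ^ 2 := by rw [← sq_abs θ]; gcongr
  rw [abs_le]
  constructor
  · have h1 : exp (-1) ≤ exp (-(1 / π ^ 2) * θ ^ 2) := by
      apply exp_le_exp.mpr
      have : 1 / π ^ 2 * θ ^ 2 ≤ 1 := by
        rw [one_div_mul_eq_div]
        exact (div_le_one hpi).mpr hsq
      linarith
    have h2 : 1 / 3 ≤ exp (-1) := by
      rw [exp_neg, one_div]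
      exact inv_anti₀ (exp_pos _) (by linarith [exp_one_lt_d9])
    linarith [neg_one_le_cos θ]
  · have h1 := cos_le_one_sub_mul_cos_sq h
    have h2 := add_one_le_exp (-(1 / π ^ 2) * θ ^ 2)
    have h3 : 0 ≤ 1 / π ^ 2 * θ ^ 2 := by positivity
    have h4 : 2 / π ^ 2 * θ ^ 2 = 2 * (1 / π ^ 2 * θ ^ 2) := by ring
    linarith

theorem tendsto_mul_cos_div_sqrt_sub_one (u : ℝ) :
    Tendsto (fun k : ℕ => (k : ℝ) * (cos (u / √k) - 1)) atTop (𝓝 (-u ^ 2 / 2)) := by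
  rw [tendsto_iff_dist_tendsto_zero]
  have hlim : Tendsto (fun k : ℕ => |u| ^ 4 * (5 / 96) / (k : ℝ)) atTop (𝓝 0) :=
    tendsto_const_div_atTop_nhds_zero_nat _
  refine squeeze_zero' (.of_forall fun _ => dist_nonneg) ?_ hlim
  filter_upwards [eventually_gt_atTop 0, eventually_ge_atTop ⌈u ^ 2⌉₊] with k hk hku
  have hk' : (0 : ℝ) < k := by exact_mod_cast hk
  have hs : √(k : ℝ) ^ 2 = k := sq_sqrt hk'.le
  have hs0 : 0 < √(k : ℝ) := sqrt_pos.mpr hk'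
  have hle : |u / √k| ≤ 1 := by
    rw [abs_div, abs_of_pos hs0, div_le_one hs0]
    apply abs_le_sqrt
    exact (Nat.le_ceil _).trans (by exact_mod_cast hku)
  have hb := cos_bound hle
  have hq : (u / √k) ^ 2 = u ^ 2 / k := by rw [div_pow, hs]
  have hq4 : |u / √k| ^ 4 = |u| ^ 4 / k ^ 2 := by
    rw [abs_div, abs_of_pos hs0, div_pow, show √(k : ℝ) ^ 4 = (√(k : ℝ) ^ 2) ^ 2 by ring, hs]
  rw [hq, hq4] at hb
  rw [Real.dist_eq]
  have e : (k : ℝ) * (cos (u / √k) - 1) - -u ^ 2 / 2 =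
      k * (cos (u / √k) - (1 - u ^ 2 / k / 2)) := by
    field_simp
    ring
  rw [e, abs_mul, abs_of_pos hk']
  calc _ ≤ (k : ℝ) * (|u| ^ 4 / k ^ 2 * (5 / 96)) := by gcongr
    _ = _ := by field_simp

theorem tendsto_sqrt_mul_trinom_div_three_pow :
    Tendsto (fun k : ℕ => √k * (trinom k / 3 ^ k)) atTop (𝓝 (√3 / (2 * √π))) := by
  set F : ℕ → ℝ → ℝ := fun k =>
    (Ioc (-π * √k) (π * √k)).indicator fun u => ((1 + 2 * cos (u / √k)) / 3) ^ k with hF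
  have hint : Tendsto (fun k => ∫ u, F k u) atTop (𝓝 (∫ u, exp (-(1 / 3) * u ^ 2))) := by
    refine tendsto_integral_filter_of_dominated_convergence
      (fun u => exp (-(1 / π ^ 2) * u ^ 2)) ?_ ?_
      (integrable_exp_neg_mul_sq (by positivity)) ?_
    · refine .of_forall fun k => (Measurable.indicator ?_ measurableSet_Ioc).aestronglyMeasurable
      fun_prop
    · filter_upwards [eventually_gt_atTop 0] with k hk
      refine .of_forall fun u => ?_
      have hk' : (0 : ℝ) < k := by exact_mod_cast hk
      have hs0 : 0 < √(k : ℝ) := sqrt_pos.mpr hk'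
      rw [hF]
      by_cases hu : u ∈ Ioc (-π * √k) (π * √k)
      · simp only [indicator_of_mem hu]
        have hle : |u / √k| ≤ π := by
          rw [abs_div, abs_of_pos hs0, div_le_iff₀ hs0, abs_le]
          exact ⟨by linarith [hu.1], hu.2⟩
        rw [norm_pow, Real.norm_eq_abs]
        calc _ ≤ exp (-(1 / π ^ 2) * (u / √k) ^ 2) ^ k := by
              gcongr
              exact abs_one_add_two_mul_cos_div_three_le hle
          _ = _ := by
              rw [← exp_nat_mul, div_pow, sq_sqrt hk'.le]
              congr 1
              field_simp
      · simp only [indicator_of_notMem hu, norm_zero]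
        positivity
    · refine .of_forall fun u => ?_
      have h1 : Tendsto (fun k : ℕ => ((1 + 2 * cos (u / √k)) / 3) ^ k) atTop
          (𝓝 (exp (-(1 / 3) * u ^ 2))) := by
        have := Real.tendsto_one_add_pow_exp_of_tendsto
          (g := fun k : ℕ => 2 / 3 * (cos (u / √k) - 1)) (t := -(1 / 3) * u ^ 2) ?_
        · refine this.congr fun k => ?_
          congr 1
          ring
        · have := (tendsto_mul_cos_div_sqrt_sub_one u).const_mul (2 / 3)
          refine (this.congr fun k => ?_).trans_eq ?_
          · ring
          · congr 1
            ring
      refine h1.congr' ?_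
      filter_upwards [eventually_gt_atTop 0, eventually_gt_atTop ⌈u ^ 2⌉₊] with k hk hku
      have hlt : |u| < √(k : ℝ) := by
        rw [← sqrt_sq_eq_abs]
        exact sqrt_lt_sqrt (sq_nonneg u) ((Nat.le_ceil _).trans_lt (by exact_mod_cast hku))
      have hlt' : |u| < π * √(k : ℝ) := by
        nlinarith [pi_gt_three, sqrt_nonneg (k : ℝ)]
      have hu : u ∈ Ioc (-π * √k) (π * √k) :=
        ⟨by linarith [(abs_lt.mp hlt').1], (abs_lt.mp hlt').2.le⟩
      rw [hF]
      simp only [indicator_of_mem hu]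
  rw [integral_gaussian] at hint
  have hconst : √3 / (2 * √π) = 1 / (2 * π) * √(π / (1 / 3)) := by
    have hpp : √π * √π = π := mul_self_sqrt pi_pos.le
    have : √(π / (1 / 3)) = √3 * √π := by rw [← sqrt_mul (by norm_num)]; congr 1; ring
    rw [this]
    field_simp
    rw [sq, hpp]
  rw [hconst]
  refine (hint.const_mul (1 / (2 * π))).congr' ?_
  filter_upwards [eventually_gt_atTop 0] with k hk
  have hk' : (0 : ℝ) < k := by exact_mod_cast hk
  have hs0 : 0 < √(k : ℝ) := sqrt_pos.mpr hk'
  have hpi := pi_pos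
  rw [hF]
  simp only
  rw [integral_indicator measurableSet_Ioc, ← intervalIntegral.integral_of_le (by nlinarith),
    intervalIntegral.integral_comp_div (fun θ => ((1 + 2 * cos θ) / 3) ^ k) hs0.ne']
  simp_rw [mul_div_cancel_right₀ _ hs0.ne', div_pow]
  rw [intervalIntegral.integral_div, integral_one_add_two_mul_cos_pow, smul_eq_mul]
  field_simp

theorem tendsto_sqrt_mul_choose_div_four_pow :
    Tendsto (fun n : ℕ => √n * ((2 * n).choose n / 4 ^ n)) atTop (𝓝 (1 / √π)) := by
  have h := (Stirling.tendsto_stirlingSeq_sqrt_pi.comp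
    (tendsto_id.const_mul_atTop' (two_pos : 0 < 2))).div
    (Stirling.tendsto_stirlingSeq_sqrt_pi.pow 2) (by positivity)
  have hc : √π / √π ^ 2 = 1 / √π := by field_simp
  rw [hc] at h
  refine h.congr' ?_
  filter_upwards [eventually_gt_atTop 0] with n hn
  have hn' : (0 : ℝ) < n := by exact_mod_cast hn
  have hs : √(n : ℝ) ^ 2 = n := sq_sqrt hn'.le
  have hs0 : 0 < √(n : ℝ) := sqrt_pos.mpr hn'
  have h4 : √(2 * (2 * (n : ℝ))) = 2 * √n := by
    rw [← mul_assoc, sqrt_mul (by norm_num), show (2 * 2 : ℝ) = 2 ^ 2 by norm_num,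
      sqrt_sq (by norm_num)]
  have hch : ((2 * n).choose n : ℝ) = (2 * n).factorial / (n.factorial * n.factorial) := by
    rw [Nat.cast_choose ℝ (by omega)]
    congr 3
    congr 1
    omega
  simp only [Pi.div_apply, Function.comp_apply, id, Stirling.stirlingSeq, hch]
  push_cast
  rw [h4, div_pow _ _ 2, mul_pow _ _ 2, sq_sqrt (by positivity), ← pow_mul, mul_comm n 2,
    div_pow, div_pow, mul_pow, pow_mul 2 2 n]
  have hf : (n.factorial : ℝ) ≠ 0 := by positivity
  norm_num
  field_simp
  rw [hs]

theorem choose_sub_succ_mul {n k : ℕ} (h : k < n) :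
    ((2 * n).choose (n - (k + 1)) : ℝ) * (n + k + 1) = (2 * n).choose (n - k) * (n - k) := by
  have := Nat.choose_succ_right_eq (2 * n) (n - (k + 1))
  have e1 : n - (k + 1) + 1 = n - k := by omega
  have e2 : 2 * n - (n - (k + 1)) = n + k + 1 := by omega
  rw [e1, e2] at this
  rw [← Nat.cast_sub h.le]
  exact_mod_cast this.symm

theorem choose_sub_le {n k m : ℕ} (hn : 0 < n) (hk : k ≤ m) (hm : m ≤ n) :
    ((2 * n).choose (n - k) : ℝ) ≤ (2 * n).choose n * exp (-(k ^ 2 / (n + m))) := by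
  induction k with
  | zero => simp
  | succ k ih =>
    have hn' : (0 : ℝ) < n := by exact_mod_cast hn
    have hkm : (k : ℝ) + 1 ≤ m := by exact_mod_cast hk
    have hpos : (0 : ℝ) < n + k + 1 := by positivity
    have hmul := choose_sub_succ_mul (n := n) (k := k) (by omega)
    have hratio : ((n : ℝ) - k) / (n + k + 1) ≤ exp (-((2 * k + 1) / (n + m))) := by
      have h1 : ((n : ℝ) - k) / (n + k + 1) = -((2 * k + 1) / (n + k + 1)) + 1 := by
        field_simp
        ring
      have h2 : (2 * (k : ℝ) + 1) / (n + m) ≤ (2 * k + 1) / (n + k + 1) := by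
        refine div_le_div_of_nonneg_left (by positivity) (by positivity) (by linarith)
      have h3 := add_one_le_exp (-((2 * (k : ℝ) + 1) / (n + m)))
      linarith
    rw [← eq_div_iff hpos.ne'] at hmul
    have hkn : (k : ℝ) + 1 ≤ n := by exact_mod_cast hk.trans hm
    calc ((2 * n).choose (n - (k + 1)) : ℝ)
        = (2 * n).choose (n - k) * ((n - k) / (n + k + 1)) := by rw [hmul, mul_div_assoc]
      _ ≤ ((2 * n).choose n * exp (-(k ^ 2 / (n + m)))) * exp (-((2 * k + 1) / (n + m))) := by
        gcongr
        · exact div_nonneg (by linarith) hpos.le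
        · exact ih (by omega)
      _ = _ := by
        rw [mul_assoc, ← exp_add]
        congr 2
        push_cast
        ring

theorem le_choose_sub {n k m : ℕ} (hk : k ≤ m) (hm : m < n) :
    ((2 * n).choose n : ℝ) * exp (-(k ^ 2 / (n - m))) ≤ (2 * n).choose (n - k) := by
  induction k with
  | zero => simp
  | succ k ih =>
    have hm' : (m : ℝ) < n := by exact_mod_cast hm
    have hkm : (k : ℝ) + 1 ≤ m := by exact_mod_cast hk
    have hpos : (0 : ℝ) < n + k + 1 := by positivity
    have hnk : (0 : ℝ) < n - k := by linarith
    have hnm : (0 : ℝ) < n - m := by linarith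
    have hmul := choose_sub_succ_mul (n := n) (k := k) (by omega)
    have hratio : exp (-((2 * k + 1) / (n - m))) ≤ ((n : ℝ) - k) / (n + k + 1) := by
      rw [exp_neg, ← inv_div ((n : ℝ) + k + 1)]
      apply inv_anti₀ (by positivity)
      have h1 : ((n : ℝ) + k + 1) / (n - k) = (2 * k + 1) / (n - k) + 1 := by
        field_simp
        ring
      have h2 : (2 * (k : ℝ) + 1) / (n - k) ≤ (2 * k + 1) / (n - m) := by
        refine div_le_div_of_nonneg_left (by positivity) hnm (by linarith)
      have h3 := add_one_le_exp ((2 * (k : ℝ) + 1) / (n - m))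
      linarith
    rw [← eq_div_iff hpos.ne'] at hmul
    calc ((2 * n).choose n : ℝ) * exp (-((k + 1 : ℕ) ^ 2 / (n - m))) =
          ((2 * n).choose n * exp (-(k ^ 2 / (n - m)))) * exp (-((2 * k + 1) / (n - m))) := by
          rw [mul_assoc, ← exp_add]
          congr 2
          push_cast
          ring
      _ ≤ (2 * n).choose (n - k) * ((n - k) / (n + k + 1)) := by
        gcongr
        exact ih (by omega)
      _ = _ := by rw [hmul, mul_div_assoc]

theorem tendsto_sqrt_mul_choose_sub_div_four_pow {κ : ℕ → ℕ} {x : ℝ}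
    (hκ : Tendsto (fun n => (κ n : ℝ) / √n) atTop (𝓝 x)) :
    Tendsto (fun n : ℕ => √n * ((2 * n).choose (n - κ n) / 4 ^ n)) atTop
      (𝓝 (1 / √π * exp (-x ^ 2))) := by
  have hsqrt : Tendsto (fun n : ℕ => √(n : ℝ)) atTop atTop :=
    tendsto_sqrt_atTop.comp tendsto_natCast_atTop_atTop
  have hdiv : Tendsto (fun n => (κ n : ℝ) / n) atTop (𝓝 0) := by
    refine (hκ.div_atTop hsqrt).congr fun n => ?_
    rw [div_div, mul_self_sqrt (Nat.cast_nonneg n)]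
  have hexp (σ : ℝ) : Tendsto (fun n => exp (-((κ n : ℝ) ^ 2 / (n + σ * κ n)))) atTop
      (𝓝 (exp (-x ^ 2))) := by
    have h1 : Tendsto (fun n => -(((κ n : ℝ) / √n) ^ 2 / (1 + σ * (κ n / n)))) atTop
        (𝓝 (-(x ^ 2 / (1 + σ * 0)))) :=
      ((hκ.pow 2).div ((hdiv.const_mul σ).const_add 1) (by simp)).neg
    simp only [mul_zero, add_zero, div_one] at h1
    refine ((continuous_exp.tendsto _).comp h1).congr' ?_
    filter_upwards [eventually_gt_atTop 0] with n hn
    have hn' : (0 : ℝ) < n := by exact_mod_cast hn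
    simp only [Function.comp_apply]
    rw [div_pow, sq_sqrt hn'.le, div_div, mul_add, mul_one, mul_left_comm,
      mul_div_cancel₀ _ hn'.ne']
  have hlt : ∀ᶠ n in atTop, κ n < n := by
    filter_upwards [hdiv.eventually_lt_const one_pos, eventually_gt_atTop 0] with n h hn
    rw [div_lt_one (by exact_mod_cast hn)] at h
    exact_mod_cast h
  refine tendsto_of_tendsto_of_tendsto_of_le_of_le'
    (tendsto_sqrt_mul_choose_div_four_pow.mul (hexp (-1)))
    (tendsto_sqrt_mul_choose_div_four_pow.mul (hexp 1)) ?_ ?_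
  · filter_upwards [hlt] with n hn
    rw [mul_assoc, div_mul_eq_mul_div, neg_one_mul, ← sub_eq_add_neg]
    gcongr
    exact le_choose_sub le_rfl hn
  · filter_upwards [hlt] with n hn
    rw [mul_assoc, div_mul_eq_mul_div, one_mul]
    gcongr
    exact choose_sub_le (by omega) le_rfl hn.le

theorem sum_Icc_eq_integral_natCeil (G : ℕ → ℝ) (n : ℕ) :
    ∑ k ∈ Finset.Icc 1 n, G k = ∫ y in (0 : ℝ)..n, G ⌈y⌉₊ := by
  have hae (k : ℕ) : ∀ y ∈ uIoc (k : ℝ) (k + 1 : ℕ), G ⌈y⌉₊ = G (k + 1) := by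
    intro y hy
    rw [uIoc_of_le (by simp)] at hy
    congr 1
    rw [Nat.ceil_eq_iff (by omega)]
    simpa using hy
  have hint (k : ℕ) : IntervalIntegrable (fun y : ℝ => G ⌈y⌉₊) volume k (k + 1 : ℕ) :=
    (intervalIntegrable_const (c := G (k + 1))).congr fun y hy => (hae k y hy).symm
  have hval (k : ℕ) : ∫ y in (k : ℝ)..(k + 1 : ℕ), G ⌈y⌉₊ = G (k + 1) := by
    rw [intervalIntegral.integral_congr_ae (.of_forall (hae k))]
    simp
  have hsum := intervalIntegral.sum_integral_adjacent_intervals (n := n)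
    (a := fun k : ℕ => (k : ℝ)) (fun k _ => hint k)
  simp only [hval, Nat.cast_zero] at hsum
  rw [← hsum]
  clear hsum
  induction n with
  | zero => simp
  | succ n ih => rw [Finset.sum_Icc_succ_top (by omega), Finset.sum_range_succ, ih]

/-- The step function whose integral over `(0, ∞)` is `n ^ (1 / 4) * a_n / (2 * 12 ^ n)`. -/
noncomputable def rescaledTerm (n : ℕ) : ℝ → ℝ :=
  (Ioc 0 √n).indicator fun x =>
    √√n * (trinom ⌈x * √n⌉₊ / 3 ^ ⌈x * √n⌉₊) *
      (√n * ((2 * n).choose (n - ⌈x * √n⌉₊) / 4 ^ n))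

theorem integral_rescaledTerm {n : ℕ} (hn : 0 < n) :
    ∫ x in Ioi 0, rescaledTerm n x = √√n * aSeq n / (2 * 12 ^ n) := by
  have hs0 : 0 < √(n : ℝ) := sqrt_pos.mpr (by exact_mod_cast hn)
  set G : ℕ → ℝ := fun k => (trinom k / 3 ^ k) * ((2 * n).choose (n - k) / 4 ^ n) with hG
  have hsum : aSeq n / (2 * 12 ^ n) = ∑ k ∈ Finset.Icc 1 n, G k := by
    rw [aSeq, mul_div_mul_left _ _ two_ne_zero, Finset.sum_div]
    refine Finset.sum_congr rfl fun k hk => ?_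
    rw [hG, pow_sub₀ _ three_ne_zero (Finset.mem_Icc.mp hk).2,
      show (12 : ℝ) = 3 * 4 by norm_num, mul_pow]
    field_simp
  rw [mul_div_assoc, hsum, sum_Icc_eq_integral_natCeil, rescaledTerm,
    setIntegral_indicator measurableSet_Ioc, inter_eq_right.mpr Ioc_subset_Ioi_self,
    ← intervalIntegral.integral_of_le hs0.le]
  have hsub := intervalIntegral.integral_comp_mul_right (a := 0) (b := √n)
    (fun y : ℝ => G ⌈y⌉₊) hs0.ne'
  rw [zero_mul, mul_self_sqrt (Nat.cast_nonneg n), smul_eq_mul,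
    eq_inv_mul_iff_mul_eq₀ hs0.ne'] at hsub
  rw [← hsub, ← intervalIntegral.integral_const_mul, ← intervalIntegral.integral_const_mul]
  congr 1
  ext x
  rw [hG]
  ring

theorem measurable_rescaledTerm (n : ℕ) : Measurable (rescaledTerm n) := by
  have hceil : Measurable fun x : ℝ => ⌈x * √n⌉₊ := Nat.measurable_ceil.comp (by fun_prop)
  exact ((measurable_from_nat (f := fun k : ℕ => √√n * ((trinom k : ℝ) / 3 ^ k) *
    (√n * ((2 * n).choose (n - k) / 4 ^ n)))).comp hceil).indicator measurableSet_Ioc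

theorem exists_norm_rescaledTerm_le :
    ∃ C : ℝ, ∀ n : ℕ, ∀ x : ℝ, 0 < x →
      ‖rescaledTerm n x‖ ≤ C * (x ^ (-(1 / 2) : ℝ) * exp (-(1 / 2) * x ^ 2)) := by
  obtain ⟨A, hA⟩ := tendsto_sqrt_mul_trinom_div_three_pow.bddAbove_range
  obtain ⟨B, hB⟩ := tendsto_sqrt_mul_choose_div_four_pow.bddAbove_range
  replace hA (k : ℕ) : √k * (trinom k / 3 ^ k) ≤ A := hA ⟨k, rfl⟩
  replace hB (n : ℕ) : √n * ((2 * n).choose n / 4 ^ n) ≤ B := hB ⟨n, rfl⟩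
  have hA0 : 0 ≤ A := by simpa using hA 0
  have hB0 : 0 ≤ B := by simpa using hB 0
  refine ⟨A * B, fun n x hx => ?_⟩
  by_cases hmem : x ∈ Ioc 0 √(n : ℝ)
  swap
  · rw [rescaledTerm, indicator_of_notMem hmem, norm_zero]
    positivity
  rw [rescaledTerm, indicator_of_mem hmem, Real.norm_of_nonneg (by positivity)]
  set k := ⌈x * √n⌉₊ with hk
  have hs0 : 0 < √(n : ℝ) := hmem.1.trans_le hmem.2
  have hn' : (0 : ℝ) < n := sqrt_pos.mp hs0
  have hsq : √(n : ℝ) * √n = n := mul_self_sqrt hn'.le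
  have hxk : x * √n ≤ k := Nat.le_ceil _
  have hkn : k ≤ n := by
    rw [hk, Nat.ceil_le]
    exact (mul_le_mul_of_nonneg_right hmem.2 hs0.le).trans_eq hsq
  have h1 : √√n * (trinom k / 3 ^ k) ≤ A * x ^ (-(1 / 2) : ℝ) := by
    have hle : √x * √√n ≤ √k := by
      rw [← sqrt_mul hx.le]
      exact sqrt_le_sqrt hxk
    rw [rpow_neg hx.le, ← sqrt_eq_rpow, ← div_eq_mul_inv, le_div_iff₀ (sqrt_pos.mpr hx)]
    calc √√n * (trinom k / 3 ^ k) * √x = (√x * √√n) * (trinom k / 3 ^ k) := by ring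
      _ ≤ √k * (trinom k / 3 ^ k) := by gcongr
      _ ≤ A := hA k
  have h2 : √n * ((2 * n).choose (n - k) / 4 ^ n) ≤ B * exp (-(1 / 2) * x ^ 2) := by
    have hexp : exp (-((k : ℝ) ^ 2 / (n + n))) ≤ exp (-(1 / 2) * x ^ 2) := by
      apply exp_le_exp.mpr
      have : x ^ 2 * n ≤ (k : ℝ) ^ 2 := by
        calc x ^ 2 * n = (x * √n) ^ 2 := by rw [mul_pow, sq_sqrt hn'.le]
          _ ≤ _ := by gcongr
      rw [neg_mul, neg_le_neg_iff, le_div_iff₀ (by positivity)]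
      linarith
    calc √n * ((2 * n).choose (n - k) / 4 ^ n)
        ≤ √n * ((2 * n).choose n * exp (-(1 / 2) * x ^ 2) / 4 ^ n) := by
          gcongr
          refine (choose_sub_le (by exact_mod_cast hn') hkn le_rfl).trans ?_
          gcongr
      _ = √n * ((2 * n).choose n / 4 ^ n) * exp (-(1 / 2) * x ^ 2) := by ring
      _ ≤ _ := by
          gcongr
          exact hB n
  calc _ ≤ (A * x ^ (-(1 / 2) : ℝ)) * (B * exp (-(1 / 2) * x ^ 2)) := by gcongr
    _ = _ := by ring

theorem tendsto_rescaledTerm {x : ℝ} (hx : 0 < x) :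
    Tendsto (fun n => rescaledTerm n x) atTop
      (𝓝 (√3 / (2 * π) * (x ^ (-(1 / 2) : ℝ) * exp (-x ^ (2 : ℝ))))) := by
  have hsqrt : Tendsto (fun n : ℕ => √(n : ℝ)) atTop atTop :=
    tendsto_sqrt_atTop.comp tendsto_natCast_atTop_atTop
  have hratio : Tendsto (fun n : ℕ => (⌈x * √n⌉₊ : ℝ) / √n) atTop (𝓝 x) :=
    (tendsto_nat_ceil_mul_div_atTop hx.le).comp hsqrt
  have hceil : Tendsto (fun n : ℕ => ⌈x * √n⌉₊) atTop atTop :=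
    tendsto_nat_ceil_atTop.comp (hsqrt.const_mul_atTop hx)
  have h1 := (tendsto_sqrt_mul_trinom_div_three_pow.comp hceil).mul
    ((hratio.sqrt).inv₀ (sqrt_pos.mpr hx).ne')
  have h2 := tendsto_sqrt_mul_choose_sub_div_four_pow hratio
  have hval : √3 / (2 * √π) * (√x)⁻¹ * (1 / √π * exp (-x ^ 2)) =
      √3 / (2 * π) * (x ^ (-(1 / 2) : ℝ) * exp (-x ^ (2 : ℝ))) := by
    rw [rpow_neg hx.le, ← sqrt_eq_rpow, rpow_two]
    rw [show 2 * π = 2 * (√π * √π) by rw [mul_self_sqrt pi_pos.le]]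
    field_simp
  rw [← hval]
  refine (h1.mul h2).congr' ?_
  filter_upwards [eventually_gt_atTop 0, hsqrt.eventually_ge_atTop x] with n hn hxn
  have hs0 : 0 < √(n : ℝ) := sqrt_pos.mpr (by exact_mod_cast hn)
  have hk : (0 : ℝ) < ⌈x * √n⌉₊ := by
    exact_mod_cast Nat.ceil_pos.mpr (mul_pos hx hs0)
  rw [rescaledTerm, indicator_of_mem (show x ∈ Ioc 0 √(n : ℝ) from ⟨hx, hxn⟩)]
  congr 1
  simp only [Function.comp_apply]
  rw [sqrt_div hk.le, inv_div]
  have := (sqrt_pos.mpr hk).ne'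
  field_simp

theorem tendsto_sqrt_sqrt_mul_aSeq_div :
    Tendsto (fun n : ℕ => √√n * aSeq n / (2 * 12 ^ n)) atTop
      (𝓝 (√3 / (2 * π) * (1 / 2 * Gamma (1 / 4)))) := by
  obtain ⟨C, hC⟩ := exists_norm_rescaledTerm_le
  have hlim : Tendsto (fun n => ∫ x in Ioi 0, rescaledTerm n x) atTop
      (𝓝 (∫ x in Ioi 0, √3 / (2 * π) * (x ^ (-(1 / 2) : ℝ) * exp (-x ^ (2 : ℝ))))) := by
    refine tendsto_integral_of_dominated_convergence
      (fun x => C * (x ^ (-(1 / 2) : ℝ) * exp (-(1 / 2) * x ^ 2)))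
      (fun n => (measurable_rescaledTerm n).aestronglyMeasurable)
      ((integrableOn_rpow_mul_exp_neg_mul_sq (by norm_num) (by norm_num)).const_mul C)
      (fun n => ?_) ?_
    · exact (ae_restrict_iff' measurableSet_Ioi).mpr (.of_forall fun x hx => hC n x hx)
    · exact (ae_restrict_iff' measurableSet_Ioi).mpr
        (.of_forall fun x hx => tendsto_rescaledTerm hx)
  rw [integral_const_mul, integral_rpow_mul_exp_neg_rpow two_pos (by norm_num),
    show (-(1 / 2) + 1 : ℝ) / 2 = 1 / 4 by norm_num] at hlim
  refine hlim.congr' ?_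
  filter_upwards [eventually_gt_atTop 0] with n hn
  exact integral_rescaledTerm hn

end

/-- Asymptotics `a_n ∼ √3 Γ(1/4) 12^n / (2π n^{1/4})` as `n → ∞`. -/
theorem aSeq_asymptotics :
    Tendsto (fun n : ℕ =>
        aSeq n * (2 * Real.pi * (n : ℝ) ^ ((1 : ℝ) / 4)) /
          (Real.sqrt 3 * Real.Gamma (1 / 4) * (12 : ℝ) ^ n))
      atTop (nhds 1) := by
  have hΓ : 0 < Real.Gamma (1 / 4) := Real.Gamma_pos_of_pos (by norm_num)
  have hπ := Real.pi_pos
  have hc : 0 < √3 / (2 * Real.pi) * (1 / 2 * Real.Gamma (1 / 4)) := by positivity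
  have h := tendsto_sqrt_sqrt_mul_aSeq_div.div_const
    (√3 / (2 * Real.pi) * (1 / 2 * Real.Gamma (1 / 4)))
  rw [div_self hc.ne'] at h
  refine h.congr fun n => ?_
  have hroot : √√(n : ℝ) = (n : ℝ) ^ ((1 : ℝ) / 4) := by
    rw [Real.sqrt_eq_rpow, Real.sqrt_eq_rpow, ← Real.rpow_mul (Nat.cast_nonneg n)]
    norm_num
  rw [hroot]
  field_simp
end

section
/- Let a_n = 2·∑_{k=1}^{n} t_k·3^{n−k}·C(2n, n−k) and b_n = (1/n)·∑_{k=1}^{n} k·t_k·3^{n−k}·C(2n, n−k). Then lim_{n→∞} a_n / (√(2n)·b_n) = √2·Γ(1/4)/Γ(3/4). (Probabilistically: the expectation of √(2n)/L_n^•, where L_n^• is the cycle length of a uniform pointed well-labelled unicycle with n edges, converges to √2·Γ(1/4)/Γ(3/4).) -/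
open Filter

/-- `b_n = (1/n) ∑_{k=1}^n k t_k 3^{n-k} C(2n, n-k)`, the number of
well-labelled unicycles with `n` edges and a distinguished oriented edge on the cycle. -/
noncomputable def bSeq (n : ℕ) : ℝ :=
  (1 / (n : ℝ)) * ∑ k ∈ Finset.Icc 1 n,
    (k : ℝ) * (trinom k : ℝ) * (3 : ℝ) ^ (n - k) * (Nat.choose (2 * n) (n - k) : ℝ)

section

open MeasureTheory Set

/-- The integral of `(1 + 2 cos θ) ^ k` over a period computes `2π t_k`. -/
theorem integral_one_add_two_cos_pow (k : ℕ) :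
    ∫ θ in (-Real.pi)..Real.pi, (1 + 2 * Real.cos θ) ^ k = 2 * Real.pi * trinom k := by
  have hexpand (θ : ℝ) : (1 + 2 * Real.cos θ) ^ k =
      ∑ s : Fin k → Fin 3, Real.cos (((∑ i, ((s i : ℤ) - 1) : ℤ) : ℝ) * θ) := by
    have h1 : ((1 + 2 * Real.cos θ : ℝ) : ℂ) =
        ∑ a : Fin 3, Complex.exp (((((a : ℕ) : ℤ) - 1 : ℤ) : ℂ) * θ * Complex.I) := by
      simp only [Fin.sum_univ_three, Complex.ofReal_add, Complex.ofReal_mul, Complex.ofReal_cos,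
        Complex.cos]
      norm_num
      ring_nf
    have h2 : (((1 + 2 * Real.cos θ) ^ k : ℝ) : ℂ) =
        ∑ s : Fin k → Fin 3,
          Complex.exp (((((∑ i, ((s i : ℤ) - 1) : ℤ) : ℝ) * θ : ℝ) : ℂ) * Complex.I) := by
      rw [Complex.ofReal_pow, h1, Fintype.sum_pow]
      refine Finset.sum_congr rfl fun s _ => ?_
      rw [← Complex.exp_sum]
      congr 1
      push_cast
      rw [Finset.sum_mul, Finset.sum_mul]
    have h3 := congrArg Complex.re h2
    rw [Complex.ofReal_re, Complex.re_sum] at h3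
    simpa only [Complex.exp_ofReal_mul_I_re] using h3
  have hcos (m : ℤ) : ∫ θ in (-Real.pi)..Real.pi, Real.cos ((m : ℝ) * θ) =
      if m = 0 then 2 * Real.pi else 0 := by
    split_ifs with hm
    · simp [hm]; ring
    · rw [intervalIntegral.integral_comp_mul_left (fun x => Real.cos x) (Int.cast_ne_zero.mpr hm),
        integral_cos]
      simp [Real.sin_int_mul_pi]
  simp_rw [hexpand]
  rw [intervalIntegral.integral_finsetSum fun s _ =>
    (by fun_prop : Continuous _).intervalIntegrable _ _]
  simp_rw [hcos]
  rw [← Finset.sum_filter, Finset.sum_const, nsmul_eq_mul, mul_comm, trinom]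

theorem abs_one_add_two_cos_div_three_le {θ : ℝ} (hθ : |θ| ≤ Real.pi) :
    |(1 + 2 * Real.cos θ) / 3| ≤ Real.exp (-(1 / Real.pi ^ 2) * θ ^ 2) := by
  have hπ := Real.pi_pos
  have hsq : 1 / Real.pi ^ 2 * θ ^ 2 ≤ 1 := by
    rw [one_div, inv_mul_le_one₀ (by positivity)]
    exact sq_le_sq.mpr (by rwa [abs_of_pos hπ])
  have hcos := Real.cos_le_one_sub_mul_cos_sq hθ
  have hexp := Real.add_one_le_exp (-(1 / Real.pi ^ 2) * θ ^ 2)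
  rw [abs_le]
  constructor
  · have h1 : Real.exp (-1) ≤ Real.exp (-(1 / Real.pi ^ 2) * θ ^ 2) :=
      Real.exp_le_exp.mpr (by linarith)
    have h2 : 1 / 3 ≤ Real.exp (-1) := by
      rw [Real.exp_neg, ← one_div]
      exact one_div_le_one_div_of_le (Real.exp_pos 1) (by linarith [Real.exp_one_lt_d9])
    linarith [Real.neg_one_le_cos θ]
  · have : 2 / Real.pi ^ 2 * θ ^ 2 = 2 * (1 / Real.pi ^ 2 * θ ^ 2) := by ring
    have h0 : 0 ≤ 1 / Real.pi ^ 2 * θ ^ 2 := by positivity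
    linarith

theorem tendsto_one_add_two_cos_div_three_pow (u : ℝ) :
    Tendsto (fun k : ℕ => ((1 + 2 * Real.cos (u / √(k : ℝ))) / 3) ^ k) atTop
      (nhds (Real.exp (-(1 / 3) * u ^ 2))) := by
  have hlim : Tendsto (fun k : ℕ => (k : ℝ) * (2 / 3 * (Real.cos (u / √(k : ℝ)) - 1))) atTop
      (nhds (-(1 / 3) * u ^ 2)) := by
    rw [tendsto_iff_norm_sub_tendsto_zero]
    refine squeeze_zero' (.of_forall fun _ => norm_nonneg _) (g := fun k : ℕ => u ^ 4 / k) ?_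
      (tendsto_const_div_atTop_nhds_zero_nat _)
    filter_upwards [eventually_ge_atTop (⌈u ^ 2⌉₊ + 1)] with k hk
    have hk0 : (0 : ℝ) < k := by exact_mod_cast (by omega : 0 < k)
    have hu : u ^ 2 ≤ k := (Nat.le_ceil _).trans (by exact_mod_cast (by omega))
    have hsq : (u / √(k : ℝ)) ^ 2 = u ^ 2 / k := by rw [div_pow, Real.sq_sqrt hk0.le]
    have hx : |u / √(k : ℝ)| ≤ 1 := by
      rw [← sq_le_one_iff_abs_le_one, hsq]
      exact (div_le_one hk0).mpr hu
    have h := Real.cos_bound hx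
    have h4 : |u / √(k : ℝ)| ^ 4 = (u ^ 2 / k) ^ 2 := by
      rw [show |u / √(k : ℝ)| ^ 4 = (|u / √(k : ℝ)| ^ 2) ^ 2 by ring, sq_abs, hsq]
    rw [hsq, h4] at h
    have heq : (k : ℝ) * (2 / 3 * (Real.cos (u / √(k : ℝ)) - 1)) - -(1 / 3) * u ^ 2 =
        2 / 3 * k * (Real.cos (u / √(k : ℝ)) - (1 - u ^ 2 / k / 2)) := by
      field_simp; ring
    rw [heq, Real.norm_eq_abs, abs_mul, abs_of_pos (by positivity)]
    calc _ ≤ 2 / 3 * k * ((u ^ 2 / k) ^ 2 * (5 / 96)) := by gcongr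
      _ = 5 / 144 * (u ^ 4 / k) := by field_simp; ring
      _ ≤ u ^ 4 / k := by
        have : 0 ≤ u ^ 4 / k := by positivity
        linarith
  refine (Real.tendsto_one_add_pow_exp_of_tendsto hlim).congr fun k => ?_
  ring_nf

/-- The local limit `√k t_k / 3 ^ k → c` for some `c > 0`. -/
theorem exists_tendsto_sqrt_mul_trinom_div : ∃ c : ℝ, 0 < c ∧
    Tendsto (fun k : ℕ => √(k : ℝ) * (trinom k / 3 ^ k)) atTop (nhds c) := by
  have hπ := Real.pi_pos
  let F : ℕ → ℝ → ℝ := fun k => (Ioc (-Real.pi * √(k : ℝ)) (Real.pi * √(k : ℝ))).indicator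
    fun u => ((1 + 2 * Real.cos (u / √(k : ℝ))) / 3) ^ k
  have hF : Tendsto (fun k => ∫ u, F k u) atTop (nhds (∫ u, Real.exp (-(1 / 3) * u ^ 2))) := by
    refine tendsto_integral_of_dominated_convergence
      (fun u => Real.exp (-(1 / Real.pi ^ 2) * u ^ 2)) (fun k => ?_)
      (integrable_exp_neg_mul_sq (by positivity)) (fun k => ?_) ?_
    · exact ((by fun_prop : Measurable _).indicator measurableSet_Ioc).aestronglyMeasurable
    · refine .of_forall fun u => ?_
      by_cases hu : u ∈ Ioc (-Real.pi * √(k : ℝ)) (Real.pi * √(k : ℝ))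
      · have hk : 0 < √(k : ℝ) := by nlinarith [hu.1, hu.2, Real.sqrt_nonneg (k : ℝ)]
        have hle : |u / √(k : ℝ)| ≤ Real.pi := by
          rw [abs_div, abs_of_pos hk, div_le_iff₀ hk]
          exact abs_le.mpr ⟨by linarith [hu.1], hu.2⟩
        simp only [F, indicator_of_mem hu, norm_pow, Real.norm_eq_abs]
        refine (pow_le_pow_left₀ (abs_nonneg _) (abs_one_add_two_cos_div_three_le hle) k).trans_eq ?_
        have hk' : (k : ℝ) ≠ 0 := fun h => by simp [h] at hk
        rw [← Real.exp_nat_mul, div_pow, Real.sq_sqrt k.cast_nonneg]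
        congr 1
        field_simp
      · simp only [F, indicator_of_notMem hu, norm_zero]
        positivity
    · refine .of_forall fun u => (tendsto_one_add_two_cos_div_three_pow u).congr' ?_
      have hs : Tendsto (fun k : ℕ => Real.pi * √(k : ℝ)) atTop atTop :=
        (Real.tendsto_sqrt_atTop.comp tendsto_natCast_atTop_atTop).const_mul_atTop hπ
      filter_upwards [hs.eventually_gt_atTop |u|] with k hk
      have := abs_lt.mp hk
      have hu : u ∈ Ioc (-Real.pi * √(k : ℝ)) (Real.pi * √(k : ℝ)) := ⟨by linarith, this.2.le⟩
      simp only [F, indicator_of_mem hu]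
  rw [integral_gaussian] at hF
  refine ⟨√(Real.pi / (1 / 3)) / (2 * Real.pi), by positivity, ?_⟩
  refine (hF.div_const (2 * Real.pi)).congr' ?_
  filter_upwards [eventually_gt_atTop 0] with k hk
  have hs : 0 < √(k : ℝ) := Real.sqrt_pos.mpr (by exact_mod_cast hk)
  simp only [F]
  rw [integral_indicator measurableSet_Ioc,
    ← intervalIntegral.integral_of_le (by nlinarith),
    intervalIntegral.integral_comp_div (fun x => ((1 + 2 * Real.cos x) / 3) ^ k) hs.ne',
    mul_div_cancel_right₀ _ hs.ne', mul_div_cancel_right₀ _ hs.ne']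
  simp_rw [div_pow]
  rw [intervalIntegral.integral_div, integral_one_add_two_cos_pow, smul_eq_mul]
  field_simp

/-- The ratio `C(2n, n-k) / C(2n, n)` for `k ≤ n`, extended by zero. -/
noncomputable def centralRatio (n k : ℕ) : ℝ :=
  if k ≤ n then ((2 * n).choose (n - k) : ℝ) / (2 * n).choose n else 0

theorem centralRatio_nonneg (n k : ℕ) : 0 ≤ centralRatio n k := by
  unfold centralRatio; split_ifs <;> positivity

theorem centralRatio_zero (n : ℕ) : centralRatio n 0 = 1 := by
  have : ((2 * n).choose n : ℝ) ≠ 0 := by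
    exact_mod_cast (Nat.choose_pos (by omega)).ne'
  simp [centralRatio, this]

theorem centralRatio_succ {n k : ℕ} (h : k < n) :
    centralRatio n (k + 1) * (n + k + 1) = centralRatio n k * (n - k) := by
  have hc := Nat.choose_succ_right_eq (2 * n) (n - (k + 1))
  rw [show n - (k + 1) + 1 = n - k by omega, show 2 * n - (n - (k + 1)) = n + k + 1 by omega] at hc
  have hc' : ((2 * n).choose (n - k) : ℝ) * (n - k) =
      (2 * n).choose (n - (k + 1)) * (n + k + 1) := by
    rw [← Nat.cast_sub h.le]
    exact_mod_cast hc
  simp only [centralRatio, if_pos h.le, if_pos (show k + 1 ≤ n from h)]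
  rw [div_mul_eq_mul_div, div_mul_eq_mul_div, hc']

theorem centralRatio_le_exp {n k m : ℕ} (hk : k ≤ m) (hm : m ≤ n) :
    centralRatio n k ≤ Real.exp (-(k : ℝ) ^ 2 / (n + m)) := by
  induction k with
  | zero => simp [centralRatio_zero]
  | succ k ih =>
    have hkn : k < n := by omega
    have hn : (0 : ℝ) < n := by exact_mod_cast (by omega : 0 < n)
    have hkm : (k : ℝ) + 1 ≤ m := by exact_mod_cast hk
    have hrec : centralRatio n (k + 1) = centralRatio n k * ((n - k) / (n + k + 1)) := by
      rw [← mul_div_assoc, eq_div_iff (by positivity), centralRatio_succ hkn]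
    have hstep : ((n : ℝ) - k) / (n + k + 1) ≤ Real.exp (-(2 * k + 1) / (n + m)) := by
      refine le_trans ?_ (Real.add_one_le_exp _)
      have h1 : ((n : ℝ) - k) / (n + k + 1) = -((2 * k + 1) / (n + k + 1)) + 1 := by
        field_simp; ring
      have h2 : (2 * k + 1 : ℝ) / (n + m) ≤ (2 * k + 1) / (n + k + 1) := by
        refine div_le_div_of_nonneg_left (by positivity) (by positivity) (by linarith)
      rw [h1, neg_div]
      linarith
    have h0 : 0 ≤ ((n : ℝ) - k) / (n + k + 1) :=
      div_nonneg (by linarith [(by exact_mod_cast hkn : (k : ℝ) < n)]) (by positivity)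
    rw [hrec]
    refine (mul_le_mul (ih (by omega)) hstep h0 (Real.exp_pos _).le).trans_eq ?_
    rw [← Real.exp_add]
    push_cast
    ring_nf

theorem exp_le_centralRatio {n k m : ℕ} (hk : k ≤ m) (hm : m ≤ n) :
    Real.exp (-(k : ℝ) ^ 2 / (n - m + 1)) ≤ centralRatio n k := by
  induction k with
  | zero => simp [centralRatio_zero]
  | succ k ih =>
    have hkn : k < n := by omega
    have hkm : (k : ℝ) + 1 ≤ m := by exact_mod_cast hk
    have hmn : (m : ℝ) ≤ n := by exact_mod_cast hm
    have hnk : (0 : ℝ) < n - k := by linarith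
    have hrec : centralRatio n (k + 1) = centralRatio n k * ((n - k) / (n + k + 1)) := by
      rw [← mul_div_assoc, eq_div_iff (by positivity), centralRatio_succ hkn]
    have hstep : Real.exp (-(2 * k + 1) / (n - m + 1)) ≤ ((n : ℝ) - k) / (n + k + 1) := by
      rw [neg_div, Real.exp_neg, inv_le_comm₀ (Real.exp_pos _) (by positivity), inv_div]
      refine le_trans ?_ (Real.add_one_le_exp _)
      have h1 : ((n : ℝ) + k + 1) / (n - k) = (2 * k + 1) / (n - k) + 1 := by
        field_simp; ring
      rw [h1]
      gcongr ?_ / ?_ + 1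
      · linarith
      · linarith
    rw [hrec]
    refine Eq.trans_le ?_ (mul_le_mul (ih (by omega)) hstep (Real.exp_pos _).le
      (centralRatio_nonneg _ _))
    rw [← Real.exp_add]
    push_cast
    ring_nf

theorem tendsto_centralRatio_ceil {x : ℝ} (hx : 0 < x) :
    Tendsto (fun n : ℕ => centralRatio n ⌈x * √(n : ℝ)⌉₊) atTop
      (nhds (Real.exp (-x ^ (2 : ℝ)))) := by
  have hs : Tendsto (fun n : ℕ => √(n : ℝ)) atTop atTop :=
    Real.tendsto_sqrt_atTop.comp tendsto_natCast_atTop_atTop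
  have hk : Tendsto (fun n : ℕ => (⌈x * √(n : ℝ)⌉₊ : ℝ) / √(n : ℝ)) atTop (nhds x) :=
    (tendsto_nat_ceil_mul_div_atTop hx.le).comp hs
  have hkn : Tendsto (fun n : ℕ => (⌈x * √(n : ℝ)⌉₊ : ℝ) / n) atTop (nhds 0) := by
    have := hk.mul (tendsto_inv_atTop_zero.comp hs)
    rw [mul_zero] at this
    refine this.congr fun n => ?_
    rw [Function.comp, ← div_eq_mul_inv, div_div, Real.mul_self_sqrt n.cast_nonneg]
  have hle : ∀ᶠ n : ℕ in atTop, ⌈x * √(n : ℝ)⌉₊ ≤ n := by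
    filter_upwards [hkn.eventually_lt_const one_pos, eventually_gt_atTop 0] with n hn h0
    rw [div_lt_one (by exact_mod_cast h0)] at hn
    exact_mod_cast hn.le
  have hexp (e : ℕ → ℝ) (he : Tendsto e atTop (nhds 1))
      (f : ℕ → ℝ) (hf : ∀ᶠ n : ℕ in atTop, f n = n * e n) :
      Tendsto (fun n : ℕ => Real.exp (-(⌈x * √(n : ℝ)⌉₊ : ℝ) ^ 2 / f n)) atTop
        (nhds (Real.exp (-x ^ (2 : ℝ)))) := by
    refine (Real.continuous_exp.tendsto _).comp ?_
    have := ((hk.pow 2).div he one_ne_zero).neg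
    rw [div_one] at this
    rw [Real.rpow_two]
    refine this.congr' ?_
    filter_upwards [hf] with n hn
    simp only [Pi.div_apply]
    rw [hn, div_pow, Real.sq_sqrt n.cast_nonneg, div_div, neg_div]
  refine tendsto_of_tendsto_of_tendsto_of_le_of_le'
    (hexp (fun n => 1 - ⌈x * √(n : ℝ)⌉₊ / n + 1 / n) ?_
      (fun n => n - ⌈x * √(n : ℝ)⌉₊ + 1) ?_)
    (hexp (fun n => 1 + ⌈x * √(n : ℝ)⌉₊ / n) ?_ (fun n => n + ⌈x * √(n : ℝ)⌉₊) ?_)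
    (hle.mono fun n h => exp_le_centralRatio le_rfl h)
    (hle.mono fun n h => centralRatio_le_exp le_rfl h)
  · simpa using (hkn.const_sub 1).add (tendsto_const_div_atTop_nhds_zero_nat (1 : ℝ))
  · filter_upwards [eventually_gt_atTop 0] with n hn
    have : (n : ℝ) ≠ 0 := by exact_mod_cast hn.ne'
    field_simp
  · simpa using hkn.const_add 1
  · filter_upwards [eventually_gt_atTop 0] with n hn
    have : (n : ℝ) ≠ 0 := by exact_mod_cast hn.ne'
    field_simp

theorem integral_Ioi_comp_ceil {F : ℕ → ℝ} {n : ℕ} (hF : ∀ k, n < k → F k = 0) {s : ℝ}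
    (hs : 0 < s) :
    ∫ x in Ioi (0 : ℝ), F ⌈x * s⌉₊ = s⁻¹ * ∑ k ∈ Finset.Icc 1 n, F k := by
  rw [integral_comp_mul_right_Ioi (fun y => F ⌈y⌉₊) 0 hs, zero_mul, smul_eq_mul,
    setIntegral_eq_of_subset_of_forall_sdiff_eq_zero measurableSet_Ioi
      (Ioc_subset_Ioi_self : Ioc (0 : ℝ) n ⊆ Ioi 0)
      (fun x hx => hF _ (Nat.lt_ceil.mpr (not_le.mp fun h => hx.2 ⟨hx.1, h⟩))),
    ← intervalIntegral.integral_of_le n.cast_nonneg]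
  have hceil (k : ℕ) : EqOn (fun _ : ℝ => F (k + 1)) (fun y : ℝ => F ⌈y⌉₊)
      (uIoc (k : ℝ) (k + 1 : ℕ)) := by
    intro y hy
    rw [uIoc_of_le (by exact_mod_cast k.le_succ)] at hy
    have : ⌈y⌉₊ = k + 1 :=
      (Nat.ceil_eq_iff k.succ_ne_zero).mpr ⟨by simpa using hy.1, hy.2⟩
    simp only [this]
  have hsum := intervalIntegral.sum_integral_adjacent_intervals (μ := volume)
    (f := fun y : ℝ => F ⌈y⌉₊) (a := fun k : ℕ => (k : ℝ)) (n := n)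
    (fun k _ => intervalIntegrable_const.congr (hceil k))
  rw [Nat.cast_zero] at hsum
  rw [← hsum]
  have hint (k : ℕ) : ∫ y in (k : ℝ)..((k + 1 : ℕ) : ℝ), F ⌈y⌉₊ = F (k + 1) := by
    rw [← intervalIntegral.integral_congr_ae (.of_forall fun y hy => hceil k hy)]
    simp
  simp_rw [hint]
  rw [Finset.range_eq_Ico, Finset.sum_Ico_add' F 0 n 1]
  rfl

theorem rpow_ceil_div_le {p x s : ℝ} (hp : p ≤ 1) (hx : 0 < x) (hs : 1 ≤ s) :
    ((⌈x * s⌉₊ : ℝ) / s) ^ p ≤ x ^ p + (x + 1) := by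
  have hs0 : 0 < s := one_pos.trans_le hs
  have hlow : x ≤ (⌈x * s⌉₊ : ℝ) / s := (le_div_iff₀ hs0).mpr (Nat.le_ceil _)
  have hup : (⌈x * s⌉₊ : ℝ) / s ≤ x + 1 := by
    rw [div_le_iff₀ hs0]
    nlinarith [Nat.ceil_lt_add_one (mul_pos hx hs0).le]
  rcases le_total p 0 with h | h
  · linarith [Real.rpow_le_rpow_of_nonpos hx hlow h]
  · have h1 := Real.rpow_le_rpow (hx.le.trans hlow) hup h
    have h2 := Real.rpow_le_rpow_of_exponent_le (by linarith : 1 ≤ x + 1) hp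
    rw [Real.rpow_one] at h2
    linarith [Real.rpow_nonneg hx.le p]

/-- Riemann sums of `k ^ p u_k C(2n, n-k) / C(2n, n)` at scale `√n`, when `u_k` converges. -/
theorem tendsto_sum_rpow_mul_centralRatio {u : ℕ → ℝ} {c p : ℝ} (hu : Tendsto u atTop (nhds c))
    (hp : -1 < p) (hp1 : p ≤ 1) :
    Tendsto (fun n : ℕ => (√(n : ℝ))⁻¹ *
        ∑ k ∈ Finset.Icc 1 n, ((k : ℝ) / √(n : ℝ)) ^ p * u k * centralRatio n k) atTop
      (nhds (c * (1 / 2 * Real.Gamma ((p + 1) / 2)))) := by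
  obtain ⟨M, hM⟩ : ∃ M, ∀ k, |u k| ≤ M := by
    obtain ⟨M, hM⟩ := hu.abs.bddAbove_range
    exact ⟨M, fun k => hM ⟨k, rfl⟩⟩
  have hM0 : 0 ≤ M := (abs_nonneg _).trans (hM 0)
  let F : ℕ → ℝ → ℝ := fun n x => ((⌈x * √((n + 1 : ℕ) : ℝ)⌉₊ : ℝ) / √((n + 1 : ℕ) : ℝ)) ^ p *
    u ⌈x * √((n + 1 : ℕ) : ℝ)⌉₊ * centralRatio (n + 1) ⌈x * √((n + 1 : ℕ) : ℝ)⌉₊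
  have hF : Tendsto (fun n => ∫ x in Ioi (0 : ℝ), F n x) atTop
      (nhds (∫ x in Ioi (0 : ℝ), c * (x ^ p * Real.exp (-x ^ (2 : ℝ))))) := by
    refine tendsto_integral_of_dominated_convergence
      (fun x => M * ((x ^ p + (x + 1)) * Real.exp (-(1 / 2) * x ^ 2))) (fun n => ?_) ?_
      (fun n => ?_) ?_
    · have hceil : Measurable fun x : ℝ => ⌈x * √((n + 1 : ℕ) : ℝ)⌉₊ :=
        Nat.measurable_ceil.comp (by fun_prop)
      exact ((measurable_from_nat (f := fun k => ((k : ℝ) / √((n + 1 : ℕ) : ℝ)) ^ p *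
        u k * centralRatio (n + 1) k)).comp hceil).aestronglyMeasurable
    · have h (q : ℝ) (hq : -1 < q) := integrableOn_rpow_mul_exp_neg_mul_sq
        (b := 1 / 2) (by norm_num) hq
      refine (((h p hp).add ((h 1 (by norm_num)).add (h 0 (by norm_num)))).const_mul M).congr
        (.of_forall fun x => ?_)
      simp only [Pi.add_apply, Real.rpow_one, Real.rpow_zero]
      ring
    · filter_upwards [ae_restrict_mem measurableSet_Ioi] with x hx
      have hn1 : (1 : ℝ) ≤ ((n + 1 : ℕ) : ℝ) := by exact_mod_cast n.succ_pos
      have hs : 1 ≤ √((n + 1 : ℕ) : ℝ) := Real.one_le_sqrt.mpr hn1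
      have hr : centralRatio (n + 1) ⌈x * √((n + 1 : ℕ) : ℝ)⌉₊ ≤ Real.exp (-(1 / 2) * x ^ 2) := by
        by_cases hk : ⌈x * √((n + 1 : ℕ) : ℝ)⌉₊ ≤ n + 1
        · refine (centralRatio_le_exp hk le_rfl).trans (Real.exp_le_exp.mpr ?_)
          have h1 : x ^ 2 * ((n + 1 : ℕ) : ℝ) ≤ (⌈x * √((n + 1 : ℕ) : ℝ)⌉₊ : ℝ) ^ 2 := by
            rw [← Real.sq_sqrt (zero_le_one.trans hn1), ← mul_pow]
            simp only [Real.sq_sqrt (zero_le_one.trans hn1)]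
            exact pow_le_pow_left₀ (mul_nonneg (le_of_lt hx) (by positivity)) (Nat.le_ceil _) 2
          rw [div_le_iff₀ (by positivity)]
          linarith
        · rw [centralRatio, if_neg hk]
          positivity
      have hpow := rpow_ceil_div_le hp1 hx hs
      simp only [F, norm_mul, Real.norm_eq_abs]
      rw [abs_of_nonneg (centralRatio_nonneg _ _), abs_of_nonneg (by positivity),
        mul_comm (_ ^ p) |_|, mul_assoc]
      have := centralRatio_nonneg (n + 1) ⌈x * √((n + 1 : ℕ) : ℝ)⌉₊
      have hx0 : 0 < x := hx
      gcongr
      exact hM _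
    · filter_upwards [ae_restrict_mem measurableSet_Ioi] with x hx
      have hx0 : 0 < x := hx
      have hs : Tendsto (fun n : ℕ => √(n : ℝ)) atTop atTop :=
        Real.tendsto_sqrt_atTop.comp tendsto_natCast_atTop_atTop
      have hk : Tendsto (fun n : ℕ => (⌈x * √(n : ℝ)⌉₊ : ℝ) / √(n : ℝ)) atTop (nhds x) :=
        (tendsto_nat_ceil_mul_div_atTop hx0.le).comp hs
      have hc : Tendsto (fun n : ℕ => ⌈x * √(n : ℝ)⌉₊) atTop atTop :=
        tendsto_nat_ceil_atTop.comp (hs.const_mul_atTop hx0)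
      have := ((hk.rpow_const (p := p) (.inl hx0.ne')).mul (hu.comp hc)).mul
        (tendsto_centralRatio_ceil hx0)
      rw [mul_comm (x ^ p), mul_assoc] at this
      exact (tendsto_add_atTop_iff_nat 1).mpr this
  rw [integral_const_mul, integral_rpow_mul_exp_neg_rpow two_pos hp] at hF
  refine (tendsto_add_atTop_iff_nat 1).mp (hF.congr fun n => ?_)
  refine integral_Ioi_comp_ceil (F := fun k => ((k : ℝ) / √((n + 1 : ℕ) : ℝ)) ^ p *
    u k * centralRatio (n + 1) k) (fun k hk => ?_) (by positivity)
  simp [centralRatio, hk.not_ge]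

theorem trinom_mul_pow_mul_choose {n k : ℕ} (h : k ≤ n) :
    (trinom k : ℝ) * (3 : ℝ) ^ (n - k) * ((2 * n).choose (n - k) : ℝ) =
      3 ^ n * (2 * n).choose n * (trinom k / 3 ^ k * centralRatio n k) := by
  have : ((2 * n).choose n : ℝ) ≠ 0 := by exact_mod_cast (Nat.choose_pos (by omega)).ne'
  rw [centralRatio, if_pos h, pow_sub₀ _ three_ne_zero h]
  field_simp

theorem aSeq_eq {n : ℕ} (hn : 0 < n) :
    aSeq n = 2 * (3 ^ n * (2 * n).choose n) * √√(n : ℝ) * ((√(n : ℝ))⁻¹ *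
      ∑ k ∈ Finset.Icc 1 n, ((k : ℝ) / √(n : ℝ)) ^ (-(1 / 2) : ℝ) *
        (√(k : ℝ) * (trinom k / 3 ^ k)) * centralRatio n k) := by
  have hn' : (0 : ℝ) < n := by exact_mod_cast hn
  rw [aSeq, ← mul_assoc, Finset.mul_sum, Finset.mul_sum]
  refine Finset.sum_congr rfl fun k hk => ?_
  obtain ⟨hk1, hkn⟩ := Finset.mem_Icc.mp hk
  have hk0 : (0 : ℝ) < k := by exact_mod_cast hk1
  have hs : √(n : ℝ) = √√(n : ℝ) ^ 2 := (Real.sq_sqrt (Real.sqrt_nonneg _)).symm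
  rw [trinom_mul_pow_mul_choose hkn, Real.rpow_neg (by positivity), ← Real.sqrt_eq_rpow,
    Real.sqrt_div hk0.le]
  have h1 : 0 < √√(n : ℝ) := by positivity
  have h2 : 0 < √(k : ℝ) := by positivity
  generalize √√(n : ℝ) = r at *
  rw [hs]
  field_simp

theorem bSeq_eq {n : ℕ} (hn : 0 < n) :
    bSeq n = 3 ^ n * (2 * n).choose n / √√(n : ℝ) * ((√(n : ℝ))⁻¹ *
      ∑ k ∈ Finset.Icc 1 n, ((k : ℝ) / √(n : ℝ)) ^ (1 / 2 : ℝ) *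
        (√(k : ℝ) * (trinom k / 3 ^ k)) * centralRatio n k) := by
  have hn' : (0 : ℝ) < n := by exact_mod_cast hn
  rw [bSeq, ← mul_assoc, Finset.mul_sum, Finset.mul_sum]
  refine Finset.sum_congr rfl fun k hk => ?_
  obtain ⟨hk1, hkn⟩ := Finset.mem_Icc.mp hk
  have hk0 : (0 : ℝ) < k := by exact_mod_cast hk1
  have hs : √(n : ℝ) = √√(n : ℝ) ^ 2 := (Real.sq_sqrt (Real.sqrt_nonneg _)).symm
  have hn4 : (n : ℝ) = √√(n : ℝ) ^ 4 := by
    rw [show √√(n : ℝ) ^ 4 = (√√(n : ℝ) ^ 2) ^ 2 by ring, ← hs, Real.sq_sqrt hn'.le]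
  have hk2 : (k : ℝ) = √(k : ℝ) ^ 2 := (Real.sq_sqrt hk0.le).symm
  rw [mul_assoc (k : ℝ), mul_assoc (k : ℝ), trinom_mul_pow_mul_choose hkn, ← Real.sqrt_eq_rpow,
    Real.sqrt_div hk0.le]
  have h1 : 0 < √√(n : ℝ) := by positivity
  have h2 : 0 < √(k : ℝ) := by positivity
  generalize √√(n : ℝ) = r at *
  generalize √(k : ℝ) = q at *
  rw [hs, hn4, hk2]
  field_simp

end

/-- `a_n / (√(2n) b_n) → √2 Γ(1/4) / Γ(3/4)`; probabilistically,
`E[√(2n)/L_n^•] → √2 Γ(1/4)/Γ(3/4)`. -/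
theorem expectation_inverse_length_limit :
    Tendsto (fun n : ℕ => aSeq n / (Real.sqrt (2 * n) * bSeq n))
      atTop (nhds (Real.sqrt 2 * Real.Gamma (1 / 4) / Real.Gamma (3 / 4))) := by
  obtain ⟨c, hc, hu⟩ := exists_tendsto_sqrt_mul_trinom_div
  have hA := tendsto_sum_rpow_mul_centralRatio (p := -(1 / 2)) hu (by norm_num) (by norm_num)
  have hB := tendsto_sum_rpow_mul_centralRatio (p := 1 / 2) hu (by norm_num) (by norm_num)
  rw [show (-(1 / 2) + 1 : ℝ) / 2 = 1 / 4 by norm_num] at hA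
  rw [show (1 / 2 + 1 : ℝ) / 2 = 3 / 4 by norm_num] at hB
  have hΓ : 0 < Real.Gamma (3 / 4) := Real.Gamma_pos_of_pos (by norm_num)
  have hlim := (hA.div hB (by positivity)).const_mul √2
  have heq : √2 * (c * (1 / 2 * Real.Gamma (1 / 4)) / (c * (1 / 2 * Real.Gamma (3 / 4)))) =
      √2 * Real.Gamma (1 / 4) / Real.Gamma (3 / 4) := by
    field_simp
  rw [heq] at hlim
  refine hlim.congr' ?_
  filter_upwards [eventually_gt_atTop 0] with n hn
  have hn' : (0 : ℝ) < n := by exact_mod_cast hn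
  have hD : (0 : ℝ) < 3 ^ n * (2 * n).choose n := by
    have : 0 < (2 * n).choose n := Nat.choose_pos (by omega)
    positivity
  have hs : √(n : ℝ) = √√(n : ℝ) ^ 2 := (Real.sq_sqrt (Real.sqrt_nonneg _)).symm
  have hr : 0 < √√(n : ℝ) := by positivity
  have h2 : √2 ^ 2 = (2 : ℝ) := Real.sq_sqrt zero_le_two
  rw [aSeq_eq hn, bSeq_eq hn, Real.sqrt_mul zero_le_two, Pi.div_apply]
  generalize (√(n : ℝ))⁻¹ * _ = A
  generalize (√(n : ℝ))⁻¹ * _ = B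
  generalize √√(n : ℝ) = r at *
  generalize (3 : ℝ) ^ n * _ = D at *
  rw [hs]
  have hden : √2 * r ^ 2 * (D / r * B) = √2 * (D * r) * B := by field_simp
  have hnum : 2 * D * r * A = √2 * (D * r) * (√2 * A) := by linear_combination (-D * r * A) * h2
  rw [hden, hnum, mul_div_mul_left _ _ (by positivity), mul_div_assoc]
end
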